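/- For every even n ≥ 2 and every 1 ≤ M ≤ 2^n, the minimum average Hamming distance satisfies β(n,M) ≥ 3n/(n+2) − n/M. -/

import Mathlib

open Finset

noncomputable def avgDist (n : ℕ) (C : Finset (Fin n → Bool)) : ℝ :=
  (1 / (C.card : ℝ) ^ 2) * ∑ c ∈ C, ∑ c' ∈ C, (hammingDist c c' : ℝ)

noncomputable def beta (n M : ℕ) : ℝ :=
  sInf {x : ℝ | ∃ C : Finset (Fin n → Bool), C.card = M ∧ avgDist n C = x}

open Polynomial in
/-- The value at `a` of the Krawtchouk polynomial of degree `k` for words of length `a + b`. -/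
noncomputable def krawtchouk (k a b : ℕ) : ℝ :=
  (((1 - X) ^ a * (1 + X) ^ b : ℝ[X])).coeff k

open Polynomial in
theorem krawtchouk_zero (k b : ℕ) : krawtchouk k 0 b = b.choose k := by
  simp [krawtchouk, coeff_one_add_X_pow]

open Polynomial in
theorem krawtchouk_swap (k a b : ℕ) : krawtchouk k b a = (-1) ^ k * krawtchouk k a b := by
  have h : ((1 - X) ^ b * (1 + X) ^ a : ℝ[X]) =
      ((1 - X) ^ a * (1 + X) ^ b : ℝ[X]).comp (C (-1) * X) := by
    simp [← sub_eq_add_neg, mul_comm]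
  rw [krawtchouk, h, comp_C_mul_X_coeff, krawtchouk, mul_comm]

theorem abs_krawtchouk_swap (k a b : ℕ) : |krawtchouk k b a| = |krawtchouk k a b| := by
  rw [krawtchouk_swap, abs_mul, abs_pow, abs_neg, abs_one, one_pow, one_mul]

open Polynomial in
theorem coeff_two_mul_X_mul_derivative (p : ℝ[X]) (k : ℕ) :
    (2 * X * derivative p).coeff k = 2 * k * p.coeff k := by
  have h : (2 * X * derivative p : ℝ[X]) = C 2 * (X * derivative p) := by
    rw [← mul_assoc]; rfl
  rw [h, coeff_C_mul]
  cases k with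
  | zero => simp
  | succ k => rw [coeff_X_mul, coeff_derivative]; push_cast; ring

open Polynomial in
theorem krawtchouk_rec_zero (k b : ℕ) :
    ((b : ℝ) + 1) * krawtchouk k 1 b = ((b : ℝ) + 1 - 2 * k) * krawtchouk k 0 (b + 1) := by
  have h : C ((b : ℝ) + 1) * ((1 - X) ^ 1 * (1 + X) ^ b : ℝ[X]) =
      C ((b : ℝ) + 1) * ((1 - X) ^ 0 * (1 + X) ^ (b + 1)) -
        2 * X * derivative ((1 - X) ^ 0 * (1 + X) ^ (b + 1) : ℝ[X]) := by
    simp [derivative_pow]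
    ring
  have h' := congrArg (fun p => coeff p k) h
  simp only [coeff_sub, coeff_C_mul, coeff_two_mul_X_mul_derivative] at h'
  simp only [krawtchouk]
  linarith

open Polynomial in
theorem krawtchouk_rec (k a b : ℕ) :
    ((b : ℝ) + 1) * krawtchouk k (a + 2) b + ((a : ℝ) + 1) * krawtchouk k a (b + 2) =
      ((a : ℝ) + b + 2 - 2 * k) * krawtchouk k (a + 1) (b + 1) := by
  have h : C ((b : ℝ) + 1) * ((1 - X) ^ (a + 2) * (1 + X) ^ b : ℝ[X]) +
      C ((a : ℝ) + 1) * ((1 - X) ^ a * (1 + X) ^ (b + 2) : ℝ[X]) =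
      C ((a : ℝ) + b + 2) * ((1 - X) ^ (a + 1) * (1 + X) ^ (b + 1)) -
        2 * X * derivative ((1 - X) ^ (a + 1) * (1 + X) ^ (b + 1) : ℝ[X]) := by
    simp [derivative_pow, show (C 2 : ℝ[X]) = 2 from rfl]
    ring
  have h' := congrArg (fun p => coeff p k) h
  simp only [coeff_sub, coeff_add, coeff_C_mul, coeff_two_mul_X_mul_derivative] at h'
  simp only [krawtchouk]
  linarith

/-- The `±1` value of a bit. -/
def bitSign (x : Bool) : ℝ := if x then -1 else 1

open Polynomial in
theorem krawtchouk_hammingDist {n : ℕ} (k : ℕ) (x y : Fin n → Bool) :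
    krawtchouk k (hammingDist x y) (n - hammingDist x y) =
      ∑ t : Finset (Fin n) with #t = k,
        (∏ i ∈ t, bitSign (x i)) * ∏ i ∈ t, bitSign (y i) := by
  have h : ((1 - X) ^ hammingDist x y * (1 + X) ^ (n - hammingDist x y) : ℝ[X]) =
      ∏ i, (1 + C (bitSign (x i) * bitSign (y i)) * X) := by
    have hs : ∀ i, (1 + C (bitSign (x i) * bitSign (y i)) * X : ℝ[X]) =
        if x i ≠ y i then 1 - X else 1 + X := by
      intro i
      cases x i <;> cases y i <;> simp [bitSign, sub_eq_add_neg]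
    have hc : #{i | ¬ x i ≠ y i} = n - hammingDist x y := by
      have := card_filter_add_card_filter_not (s := (univ : Finset (Fin n))) (fun i => x i ≠ y i)
      rw [card_univ, Fintype.card_fin] at this
      rw [hammingDist]
      omega
    rw [prod_congr rfl fun i _ => hs i, prod_ite, prod_const, prod_const, hc]
    rfl
  rw [krawtchouk, h, prod_one_add, finsetSum_coeff, powerset_univ, sum_filter]
  refine sum_congr rfl fun t _ => ?_
  rw [prod_mul_distrib, prod_const, ← map_prod, coeff_C_mul, coeff_X_pow, prod_mul_distrib]
  simp [eq_comm]

theorem sum_krawtchouk_hammingDist_nonneg {n : ℕ} (k : ℕ) (C : Finset (Fin n → Bool)) :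
    0 ≤ ∑ x ∈ C, ∑ y ∈ C, krawtchouk k (hammingDist x y) (n - hammingDist x y) := by
  have h : ∑ x ∈ C, ∑ y ∈ C, krawtchouk k (hammingDist x y) (n - hammingDist x y) =
      ∑ t : Finset (Fin n) with #t = k, (∑ x ∈ C, ∏ i ∈ t, bitSign (x i)) ^ 2 := by
    simp only [krawtchouk_hammingDist, sq, sum_mul_sum]
    rw [sum_congr rfl fun x _ => sum_comm, sum_comm]
  rw [h]
  positivity

/-- The sequence of values of the Krawtchouk polynomial of degree `m + 1` for length `2 * m`. -/
noncomputable def midKrawtchouk (m i : ℕ) : ℝ := krawtchouk (m + 1) i (2 * m - i)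

theorem midKrawtchouk_zero_pos {m : ℕ} (hm : 1 ≤ m) : 0 < midKrawtchouk m 0 := by
  rw [midKrawtchouk, krawtchouk_zero]
  exact_mod_cast Nat.choose_pos (by omega)

theorem abs_midKrawtchouk_sub {m i : ℕ} (hi : i ≤ 2 * m) :
    |midKrawtchouk m (2 * m - i)| = |midKrawtchouk m i| := by
  rw [midKrawtchouk, midKrawtchouk, Nat.sub_sub_self hi, abs_krawtchouk_swap]

theorem midKrawtchouk_rec_zero {m : ℕ} (hm : 1 ≤ m) :
    (m : ℝ) * midKrawtchouk m 1 = -midKrawtchouk m 0 := by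
  have h := krawtchouk_rec_zero (m + 1) (2 * m - 1)
  rw [show 2 * m - 1 + 1 = 2 * m - 0 by omega] at h
  have hc : ((2 * m - 1 : ℕ) : ℝ) = 2 * m - 1 := by
    rw [Nat.cast_sub (by omega)]; simp
  rw [hc] at h
  push_cast at h
  simp only [midKrawtchouk]
  linarith

theorem midKrawtchouk_rec {m i : ℕ} (hi : i + 2 ≤ 2 * m) :
    (2 * m - i - 1 : ℝ) * midKrawtchouk m (i + 2) =
      -2 * midKrawtchouk m (i + 1) - (i + 1) * midKrawtchouk m i := by
  obtain ⟨b, hb⟩ := Nat.exists_eq_add_of_le hi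
  have h := krawtchouk_rec (m + 1) i b
  have hc : (2 * m : ℝ) = i + 2 + b := by exact_mod_cast hb
  simp only [midKrawtchouk, show 2 * m - (i + 2) = b by omega,
    show 2 * m - (i + 1) = b + 1 by omega, show 2 * m - i = b + 2 by omega]
  push_cast at h
  rw [hc]
  linear_combination h - krawtchouk (m + 1) (i + 1) (b + 1) * hc

theorem midKrawtchouk_two {m : ℕ} (hm : 1 ≤ m) :
    (m : ℝ) * (2 * m - 1) * midKrawtchouk m 2 = (2 - m) * midKrawtchouk m 0 := by
  have h1 := midKrawtchouk_rec_zero hm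
  have h2 := midKrawtchouk_rec (m := m) (i := 0) (by omega)
  norm_num at h2
  linear_combination (m : ℝ) * h2 - 2 * h1

theorem midKrawtchouk_three {m : ℕ} (hm : 2 ≤ m) :
    (m : ℝ) * (2 * m - 1) * midKrawtchouk m 3 = 3 * midKrawtchouk m 0 := by
  have h1 := midKrawtchouk_rec_zero (m := m) (by omega)
  have h2 := midKrawtchouk_two (m := m) (by omega)
  have h3 := midKrawtchouk_rec (m := m) (i := 1) (by omega)
  norm_num at h3
  have hm' : (2 : ℝ) ≤ m := by exact_mod_cast hm
  refine mul_left_cancel₀ (show (2 * m - 2 : ℝ) ≠ 0 by linarith) ?_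
  linear_combination (m : ℝ) * (2 * m - 1) * h3 - 2 * h2 - 2 * (2 * m - 1) * h1

theorem abs_midKrawtchouk_le_of_le_half {m : ℕ} (i : ℕ) (hi : 2 ≤ i) (him : i ≤ m) :
    (m : ℝ) * (2 * m - 1) * |midKrawtchouk m i| ≤ (m + 4) * midKrawtchouk m 0 := by
  have hm' : (2 : ℝ) ≤ m := by exact_mod_cast hi.trans him
  have h0 := midKrawtchouk_zero_pos (m := m) (by omega)
  have hpos : (0 : ℝ) < m * (2 * m - 1) := mul_pos (by linarith) (by linarith)
  induction i using Nat.strong_induction_on with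
  | _ i ih =>
    rcases (by omega : i = 2 ∨ i = 3 ∨ 4 ≤ i) with rfl | rfl | h4
    · rw [← abs_of_pos hpos, ← abs_mul, midKrawtchouk_two (by omega), abs_mul, abs_of_pos h0]
      gcongr
      rw [abs_le]
      constructor <;> linarith
    · rw [← abs_of_pos hpos, ← abs_mul, midKrawtchouk_three (by omega), abs_mul, abs_of_pos h0]
      gcongr
      rw [abs_le]
      constructor <;> linarith
    · obtain ⟨j, rfl⟩ := Nat.exists_eq_add_of_le' (show 2 ≤ i by omega)
      have h1 := ih (j + 1) (by omega) (by omega) (by omega)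
      have h2 := ih j (by omega) (by omega) (by omega)
      have hr := midKrawtchouk_rec (m := m) (i := j) (by omega)
      have hjm : (j : ℝ) + 2 ≤ m := by exact_mod_cast him
      have hj0 : (0 : ℝ) ≤ j := j.cast_nonneg
      have hden : (0 : ℝ) < 2 * m - j - 1 := by linarith
      have habs : (2 * m - j - 1 : ℝ) * |midKrawtchouk m (j + 2)| ≤
          2 * |midKrawtchouk m (j + 1)| + (j + 1) * |midKrawtchouk m j| := by
        rw [← abs_of_pos hden, ← abs_mul, hr]
        refine (abs_sub _ _).trans_eq ?_
        rw [abs_mul, abs_mul, abs_neg, abs_two, abs_of_nonneg (by linarith : (0 : ℝ) ≤ j + 1)]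
      refine le_of_mul_le_mul_left ?_ hden
      calc (2 * m - j - 1 : ℝ) * (m * (2 * m - 1) * |midKrawtchouk m (j + 2)|)
          = m * (2 * m - 1) * ((2 * m - j - 1) * |midKrawtchouk m (j + 2)|) := by ring
        _ ≤ m * (2 * m - 1) *
            (2 * |midKrawtchouk m (j + 1)| + (j + 1) * |midKrawtchouk m j|) := by gcongr
        _ = 2 * (m * (2 * m - 1) * |midKrawtchouk m (j + 1)|) +
            (j + 1) * (m * (2 * m - 1) * |midKrawtchouk m j|) := by ring
        _ ≤ 2 * ((m + 4) * midKrawtchouk m 0) + (j + 1) * ((m + 4) * midKrawtchouk m 0) := by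
          gcongr
        _ = (j + 3) * ((m + 4) * midKrawtchouk m 0) := by ring
        _ ≤ (2 * m - j - 1) * ((m + 4) * midKrawtchouk m 0) := by
          gcongr
          linarith

theorem abs_midKrawtchouk_le {m i : ℕ} (hi : 2 ≤ i) (him : i + 2 ≤ 2 * m) :
    (m : ℝ) * (2 * m - 1) * |midKrawtchouk m i| ≤ (m + 4) * midKrawtchouk m 0 := by
  rcases le_total i m with h | h
  · exact abs_midKrawtchouk_le_of_le_half i hi h
  · rw [← abs_midKrawtchouk_sub (by omega)]
    exact abs_midKrawtchouk_le_of_le_half _ (by omega) (by omega)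

theorem midKrawtchouk_le {m i : ℕ} (hi : 1 ≤ i) (him : i ≤ 2 * m) :
    (m : ℝ) * (2 * m - 1) * midKrawtchouk m i ≤ (i * (m + 1) - 3 * m) * midKrawtchouk m 0 := by
  have hm1 : 1 ≤ m := by omega
  have hm1' : (1 : ℝ) ≤ m := by exact_mod_cast hm1
  have h0 := midKrawtchouk_zero_pos hm1
  have hpos : (0 : ℝ) < m * (2 * m - 1) := mul_pos (by linarith) (by linarith)
  have h1 := midKrawtchouk_rec_zero hm1
  rcases (by omega : i = 1 ∨ i = 2 ∨ i = 3 ∨ (4 ≤ i ∧ i + 2 ≤ 2 * m) ∨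
    (4 ≤ i ∧ i = 2 * m - 1) ∨ (4 ≤ i ∧ i = 2 * m)) with
    rfl | rfl | rfl | ⟨h4, hi2⟩ | ⟨h4, hi2⟩ | ⟨h4, hi2⟩
  · push_cast
    exact le_of_eq (by linear_combination (2 * m - 1 : ℝ) * h1)
  · push_cast
    exact le_of_eq (by linear_combination midKrawtchouk_two hm1)
  · push_cast
    exact le_of_eq (by linear_combination midKrawtchouk_three (m := m) (by omega))
  · have h4' : (4 : ℝ) ≤ i := by exact_mod_cast h4
    calc _ ≤ (m : ℝ) * (2 * m - 1) * |midKrawtchouk m i| := by gcongr; exact le_abs_self _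
      _ ≤ (m + 4) * midKrawtchouk m 0 := abs_midKrawtchouk_le (by omega) hi2
      _ ≤ _ := by gcongr; nlinarith
  · have hm3 : (3 : ℝ) ≤ m := by exact_mod_cast (by omega : 3 ≤ m)
    have hci : (i : ℝ) = 2 * m - 1 := by
      rw [hi2, Nat.cast_sub (by omega)]; simp
    have ha : (m : ℝ) * |midKrawtchouk m i| = midKrawtchouk m 0 := by
      rw [hi2, abs_midKrawtchouk_sub (by omega), ← abs_of_pos h0, ← abs_neg (midKrawtchouk m 0),
        ← h1, abs_mul, Nat.abs_cast]
    calc _ ≤ (m : ℝ) * (2 * m - 1) * |midKrawtchouk m i| := by gcongr; exact le_abs_self _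
      _ = (2 * m - 1) * midKrawtchouk m 0 := by rw [← ha]; ring
      _ ≤ _ := by
        rw [hci]
        exact mul_le_mul_of_nonneg_right (by nlinarith) h0.le
  · have hci : (i : ℝ) = 2 * m := by exact_mod_cast hi2
    have ha : |midKrawtchouk m i| = midKrawtchouk m 0 := by
      have := abs_midKrawtchouk_sub (m := m) (i := 0) (by omega)
      rw [hi2, ← abs_of_pos h0, ← this, Nat.sub_zero]
    calc _ ≤ (m : ℝ) * (2 * m - 1) * |midKrawtchouk m i| := by gcongr; exact le_abs_self _
      _ = _ := by rw [ha, hci]; ring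

theorem le_sum_hammingDist {m : ℕ} (hm : 1 ≤ m) (C : Finset (Fin (2 * m) → Bool)) :
    3 * (m : ℝ) * (#C : ℝ) ^ 2 - 2 * m * (m + 1) * #C ≤
      (m + 1) * ∑ x ∈ C, ∑ y ∈ C, (hammingDist x y : ℝ) := by
  have h0 := midKrawtchouk_zero_pos hm
  have hpt : ∀ x y : Fin (2 * m) → Bool,
      (m : ℝ) * (2 * m - 1) * midKrawtchouk m (hammingDist x y) ≤
        midKrawtchouk m 0 * ((m + 1) * hammingDist x y - 3 * m +
          if x = y then 2 * (m : ℝ) * (m + 1) else 0) := by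
    intro x y
    split_ifs with hxy
    · rw [hxy, hammingDist_self]
      exact le_of_eq (by push_cast; ring)
    · refine (midKrawtchouk_le (hammingDist_pos.2 hxy) ?_).trans_eq (by ring)
      simpa using hammingDist_le_card_fintype (x := x) (y := y)
  have hm1' : (1 : ℝ) ≤ m := by exact_mod_cast hm
  have hpos : (0 : ℝ) < m * (2 * m - 1) := mul_pos (by linarith) (by linarith)
  have hnonneg := mul_nonneg hpos.le (sum_krawtchouk_hammingDist_nonneg (m + 1) C)
  have hle : (m : ℝ) * (2 * m - 1) * ∑ x ∈ C, ∑ y ∈ C,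
      krawtchouk (m + 1) (hammingDist x y) (2 * m - hammingDist x y) ≤
      midKrawtchouk m 0 * ∑ x ∈ C, ∑ y ∈ C, ((m + 1) * (hammingDist x y : ℝ) - 3 * m +
        if x = y then 2 * (m : ℝ) * (m + 1) else 0) := by
    simp only [mul_sum]
    exact sum_le_sum fun x _ => sum_le_sum fun y _ => hpt x y
  have hsum := nonneg_of_mul_nonneg_right (hnonneg.trans hle) h0
  have heq : ∑ x ∈ C, ∑ y ∈ C, ((m + 1) * (hammingDist x y : ℝ) - 3 * m +
      if x = y then 2 * (m : ℝ) * (m + 1) else 0) =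
      (m + 1) * ∑ x ∈ C, ∑ y ∈ C, (hammingDist x y : ℝ) - 3 * m * (#C : ℝ) ^ 2 +
        2 * m * (m + 1) * #C := by
    simp only [sum_add_distrib, sum_sub_distrib, sum_const, sum_ite_eq, ← mul_sum, nsmul_eq_mul]
    rw [sum_congr rfl fun x hx => if_pos hx]
    simp only [sum_const, nsmul_eq_mul]
    ring
  linarith

theorem stmt_18 (n M : ℕ) (he : Even n) (hn : 2 ≤ n) (hM1 : 1 ≤ M) (hM2 : M ≤ 2 ^ n) :
    beta n M ≥ 3 * (n : ℝ) / ((n : ℝ) + 2) - (n : ℝ) / (M : ℝ) := by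
  obtain ⟨m, rfl⟩ := even_iff_exists_two_mul.1 he
  obtain ⟨C₀, -, hC₀⟩ := exists_subset_card_eq
    (s := (univ : Finset (Fin (2 * m) → Bool))) (n := M) (by simpa using hM2)
  refine le_csInf ⟨_, C₀, hC₀, rfl⟩ ?_
  rintro _ ⟨C, rfl, rfl⟩
  have h := le_sum_hammingDist (by omega : 1 ≤ m) C
  have hC : (0 : ℝ) < #C := by exact_mod_cast hM1
  rw [avgDist, one_div_mul_eq_div, le_div_iff₀ (by positivity)]
  push_cast
  have hm : (0 : ℝ) < m + 1 := by positivity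
  refine le_of_mul_le_mul_left (le_trans (le_of_eq ?_) h) hm
  field_simp
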